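/- arXiv:1005.2230 — 3 statements merged into one kernel-verified Lean document; each statement's English description precedes it below -/
import Mathlib

section
/- Let (M,ω) be an n-plectic manifold. For Hamiltonian (n−1)-forms α₁, α₂, α₃ with Hamiltonian vector fields v_{α₁}, v_{α₂}, v_{α₃}, the bracket satisfies the Jacobi identity up to an exact (n−1)-form: {α₁,{α₂,α₃}} − {{α₁,α₂},α₃} − {α₂,{α₁,α₃}} = −d ι(v_{α₁} ∧ v_{α₂} ∧ v_{α₃}) ω, where ι(v₁ ∧ v₂ ∧ v₃) ω = ι_{v₃} ι_{v₂} ι_{v₁} ω. -/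
open scoped Classical

/-- An abstract setting for the Cartan calculus on a smooth manifold `M`:
the points of `M`, its tangent spaces, the spaces `Ω^k(M)` of (smooth) differential
`k`-forms, the space `𝔛(M)` of (smooth) vector fields, together with the de Rham
differential `d`, interior products `ι`, the wedge product, and the Lie bracket of
vector fields, satisfying the standard identities of the Cartan calculus.
(`Form k` plays the role of `Ω^k(M)`, and `iota k : VF → Form k →ₗ Form (k-1)` is the
interior product, which vanishes on `Form 0`.) -/
structure CartanCalculus where
  /-- the points of the manifold -/
  Point : Type
  /-- the tangent space at each point -/
  Tangent : Point → Type
  [tangentAddCommGroup : ∀ x, AddCommGroup (Tangent x)]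
  [tangentModule : ∀ x, Module ℝ (Tangent x)]
  /-- the space of smooth differential `k`-forms -/
  Form : ℕ → Type
  [formAddCommGroup : ∀ k, AddCommGroup (Form k)]
  [formModule : ∀ k, Module ℝ (Form k)]
  /-- the space of smooth vector fields -/
  VF : Type
  [vfAddCommGroup : AddCommGroup VF]
  [vfModule : Module ℝ VF]
  /-- evaluation of a vector field at a point -/
  evalVF : VF →ₗ[ℝ] ((x : Point) → Tangent x)
  /-- evaluation of a `k`-form at a point, as an alternating multilinear map on the
  tangent space -/
  evalForm : (k : ℕ) → Form k →ₗ[ℝ] ((x : Point) → (Tangent x) [⋀^Fin k]→ₗ[ℝ] ℝ)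
  /-- the constant function `1 ∈ Ω^0(M) = C^∞(M)` -/
  one : Form 0
  /-- the de Rham (exterior) differential -/
  d : (k : ℕ) → Form k →ₗ[ℝ] Form (k+1)
  /-- the interior product (contraction) of a vector field with a form; it is the zero map
  on `0`-forms -/
  iota : (k : ℕ) → VF →ₗ[ℝ] Form k →ₗ[ℝ] Form (k-1)
  /-- the wedge product of forms -/
  wedge : (k l : ℕ) → Form k →ₗ[ℝ] Form l →ₗ[ℝ] Form (k+l)
  /-- the Lie bracket of vector fields -/
  bracketVF : VF →ₗ[ℝ] VF →ₗ[ℝ] VF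
  /-- vector fields are determined by their pointwise values -/
  evalVF_injective : Function.Injective evalVF
  /-- every tangent vector is the value of some (smooth) vector field -/
  evalVF_surjective : ∀ (x : Point) (v : Tangent x), ∃ X, evalVF X x = v
  /-- forms are determined by their pointwise values -/
  evalForm_injective : ∀ k, Function.Injective (evalForm k)
  evalForm_one : ∀ x, evalForm 0 one x (fun i => i.elim0) = 1
  d_one : d 0 one = 0
  d_d : ∀ (k : ℕ) (α : Form k), d (k+1) (d k α) = 0
  iota_zero : iota 0 = 0
  evalForm_iota : ∀ (k : ℕ) (X : VF) (α : Form (k+1)) (x : Point) (u : Fin k → Tangent x),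
    evalForm k (iota (k+1) X α) x u = evalForm (k+1) α x (Fin.cons (evalVF X x) u)
  evalForm_wedge : ∀ (k l : ℕ) (α : Form k) (β : Form l) (x : Point)
      (v : Fin (k+l) → Tangent x),
    evalForm (k+l) (wedge k l α β) x v
      = ((k.factorial * l.factorial : ℝ))⁻¹ *
          ∑ σ : Equiv.Perm (Fin (k+l)),
            ((Equiv.Perm.sign σ : ℤ) : ℝ) *
              (evalForm k α x (fun i => v (σ (Fin.castAdd l i))) *
               evalForm l β x (fun i => v (σ (Fin.natAdd k i))))
  d_wedge : ∀ (k l : ℕ) (α : Form k) (β : Form l),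
    d (k+l) (wedge k l α β)
      = cast (congrArg Form (by omega : (k+1)+l = (k+l)+1)) (wedge (k+1) l (d k α) β)
        + (show Form ((k+l)+1) from ((-1 : ℤ)^k) • wedge k (l+1) α (d l β))
  bracketVF_skew : ∀ X Y, bracketVF X Y = - bracketVF Y X
  bracketVF_jacobi : ∀ X Y Z,
    bracketVF X (bracketVF Y Z)
      = bracketVF (bracketVF X Y) Z + bracketVF Y (bracketVF X Z)
  /-- the Cartan commutator identity `ι_{[X,Y]} = [L_X, ι_Y]`, where
  `L_X = d ∘ ι_X + ι_X ∘ d` is the Lie derivative -/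
  iota_bracketVF : ∀ (k : ℕ) (X Y : VF) (α : Form (k+2)),
    iota (k+2) (bracketVF X Y) α
      = d k (iota (k+1) X (iota (k+2) Y α))
        + (show Form (k+1) from iota (k+2) X (d (k+1) (iota (k+2) Y α)))
        - (show Form (k+1) from iota (k+2) Y
            ((show Form (k+2) from d (k+1) (iota (k+2) X α))
              + (show Form (k+2) from iota (k+3) X (d (k+2) α))))

attribute [instance] CartanCalculus.tangentAddCommGroup CartanCalculus.tangentModule
  CartanCalculus.formAddCommGroup CartanCalculus.formModule
  CartanCalculus.vfAddCommGroup CartanCalculus.vfModule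

namespace CartanCalculus

variable (S : CartanCalculus)

/-- The de Rham differential `Ω^{k-1}(M) → Ω^k(M)`, interpreted as the zero map for
`k = 0` (i.e. `Ω^{-1}(M) = 0`). -/
def dLow : (k : ℕ) → S.Form (k-1) →ₗ[ℝ] S.Form k
  | 0 => 0
  | (r+1) => S.d r

/-- The Lie derivative of a `k`-form along a vector field, via Cartan's magic formula
`L_X = d ∘ ι_X + ι_X ∘ d`. -/
def lieD (k : ℕ) (X : S.VF) (α : S.Form k) : S.Form k :=
  S.dLow k (S.iota k X α) + (show S.Form k from S.iota (k+1) X (S.d k α))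

/-- `ω` is an `n`-plectic structure: it is a closed `(n+1)`-form which is nondegenerate,
i.e. for every point `x` and tangent vector `v` at `x`, `ι_v ω = 0` implies `v = 0`. -/
def IsPlectic (n : ℕ) (ω : S.Form (n+1)) : Prop :=
  S.d (n+1) ω = 0 ∧
    ∀ (x : S.Point) (v : S.Tangent x),
      (∀ u : Fin n → S.Tangent x, S.evalForm (n+1) ω x (Fin.cons v u) = 0) → v = 0

/-- `X` is a Hamiltonian vector field for the `(n-1)`-form `α`, i.e. `dα = -ι_X ω`.
Here and below the `n`-plectic case is parametrized as `n = m + 1`, so that the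
`n`-plectic form `ω` has degree `m + 2 = n + 1` and Hamiltonian forms have
degree `m = n - 1`. -/
def IsHamPair (m : ℕ) (ω : S.Form (m+2)) (α : S.Form m) (X : S.VF) : Prop :=
  S.d m α = - S.iota (m+2) X ω

/-- `α` is a Hamiltonian `(n-1)`-form (with `n = m+1`). -/
def IsHamiltonian (m : ℕ) (ω : S.Form (m+2)) (α : S.Form m) : Prop :=
  ∃ X, S.IsHamPair m ω α X

/-- The bracket `{α, β} = ι_{v_β} ι_{v_α} ω` of Hamiltonian `(n-1)`-forms, expressed in
terms of their Hamiltonian vector fields `X = v_α` and `Y = v_β`. -/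
def hamBracket (m : ℕ) (ω : S.Form (m+2)) (X Y : S.VF) : S.Form m :=
  S.iota (m+1) Y (S.iota (m+2) X ω)

/-- The iterated interior product `ι(v₁ ∧ ⋯ ∧ v_k) α = ι_{v_k} ⋯ ι_{v_1} α` of a
decomposable multivector field with a form. -/
def itIota (N : ℕ) : (k : ℕ) → (Fin k → S.VF) → S.Form N → S.Form (N - k)
  | 0, _, α => α
  | (k+1), v, α => S.iota (N - k) (v (Fin.last k)) (itIota N k (fun i => v i.castSucc) α)

/-- The Hamiltonian vector field of `α` (an arbitrary one when it exists; it is unique by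
nondegeneracy, and we set it to `0` when `α` is not Hamiltonian). -/
noncomputable def hamVF (m : ℕ) (ω : S.Form (m+2)) (α : S.Form m) : S.VF :=
  if h : S.IsHamiltonian m ω α then h.choose else 0

/-- The vector space of Hamiltonian `(n-1)`-forms (with `n = m+1`). -/
def hamSubmodule (m : ℕ) (ω : S.Form (m+2)) : Submodule ℝ (S.Form m) where
  carrier := {α | S.IsHamiltonian m ω α}
  zero_mem' := ⟨0, by simp [IsHamPair]⟩
  add_mem' := by
    rintro a b ⟨X, hX⟩ ⟨Y, hY⟩
    refine ⟨X + Y, ?_⟩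
    simp only [IsHamPair] at *
    simp [map_add, LinearMap.add_apply, hX, hY]
    abel
  smul_mem' := by
    rintro c a ⟨X, hX⟩
    refine ⟨c • X, ?_⟩
    simp only [IsHamPair] at *
    simp [map_smul, LinearMap.smul_apply, hX]

/-- The subspace `dΩ^{n-2}(M)` of exact `(n-1)`-forms (with `n = m+1`; for `n = 1` this
is the zero subspace). -/
def exactSubmodule (m : ℕ) : Submodule ℝ (S.Form m) :=
  LinearMap.range (S.dLow m)

section Complex

/-- The underlying space of the `n`-term complex
`C^∞(M) → Ω^1(M) → ⋯ → Ω^{n-2}(M) → Ω^{n-1}(M)` (with `n = m+1`): families of forms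
of degrees `0, …, m`.  The graded piece of (complex) degree `i` consists of those
families supported in form-degree `m - i`, and the honest complex `L` further requires
the degree-`m` form (the complex-degree-`0` component) to be Hamiltonian; see
`IsHomogeneous` and `InComplex` below. -/
def cochainSpace (m : ℕ) : Submodule ℝ ((p : ℕ) → S.Form p) where
  carrier := {f | ∀ p, m < p → f p = 0}
  zero_mem' := fun p _ => rfl
  add_mem' := by
    intro a b ha hb p hp
    show a p + b p = 0
    rw [ha p hp, hb p hp, add_zero]
  smul_mem' := by
    intro c a ha p hp
    show c • a p = 0
    rw [ha p hp, smul_zero]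

/-- An element of the complex underlying the Lie `n`-algebra. -/
abbrev Cochain (m : ℕ) := ↥(S.cochainSpace m)

/-- `x` is homogeneous of (complex) degree `i`, i.e. concentrated in form-degree `m - i`
(recall `L_i = Ω^{n-1-i}(M)` for `i > 0` and `L_0 = Ham^{n-1}(M) ⊆ Ω^{n-1}(M)`,
with `n = m+1`). -/
def IsHomogeneous (m i : ℕ) (x : S.Cochain m) : Prop :=
  i ≤ m ∧ ∀ p, p ≠ m - i → (x : (p : ℕ) → S.Form p) p = 0

/-- `x` belongs to the complex `L` (the degree-`0` component must be Hamiltonian). -/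
def InComplex (m : ℕ) (ω : S.Form (m+2)) (x : S.Cochain m) : Prop :=
  S.IsHamiltonian m ω ((x : (p : ℕ) → S.Form p) m)

/-- The element of the complex concentrated in form-degree `p₀` with value `γ`. -/
def singleCochain (m p₀ : ℕ) (hp : p₀ ≤ m) (γ : S.Form p₀) : S.Cochain m :=
  ⟨fun p => if h : p = p₀ then cast (congrArg S.Form h.symm) γ else 0,
   fun p hp' => dif_neg (by omega)⟩

/-- The differential `l₁` of the complex: the de Rham differential on components of
positive complex degree (form-degree `< m`), and `0` on the degree-`0` part. -/
def ell1 (m : ℕ) (x : S.Cochain m) : S.Cochain m :=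
  ⟨fun p => Nat.casesOn p (0 : S.Form 0)
      (fun q => if q + 1 ≤ m then S.d q ((x : (p : ℕ) → S.Form p) q) else 0),
   by
    intro p hp
    cases p with
    | zero => exact absurd hp (Nat.not_lt_zero m)
    | succ q => exact if_neg (by omega)⟩

/-- The sign `(-1)^{k/2+1}` for `k` even and `(-1)^{(k-1)/2}` for `k` odd, appearing in
the definition of the multibrackets `l_k`. -/
def signCoef (k : ℕ) : ℤ :=
  if Even k then (-1)^(k/2+1) else (-1)^((k-1)/2)

/-- The multibrackets `l_k` of the Lie `n`-algebra `L_∞(M,ω)`: `l_1` is the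
differential of the complex, and for `k ≥ 2`, `l_k` vanishes except on arguments of
(complex) degree `0`, where it is `±ι(v_{α_1} ∧ ⋯ ∧ v_{α_k}) ω` placed in
form-degree `m+2-k`, with sign given by `signCoef`. -/
noncomputable def ell (m : ℕ) (ω : S.Form (m+2)) :
    (k : ℕ) → (Fin k → S.Cochain m) → S.Cochain m
  | 0, _ => 0
  | 1, x => S.ell1 m (x 0)
  | (k+2), x =>
      S.singleCochain m (m - k) (Nat.sub_le m k)
        (signCoef (k+2) •
          cast (congrArg S.Form (by omega : m + 2 - (k+2) = m - k))
            (S.itIota (m+2) (k+2)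
              (fun i => S.hamVF m ω ((x i : (p : ℕ) → S.Form p) m)) ω))

/-- The Koszul sign `ε(σ; x_1, …, x_k)` of a permutation `σ`, where the argument `x_a`
has degree `D a`: the sign picked up from the graded commutations, not including the
sign `(-1)^σ` of the permutation. -/
def koszulSign (k : ℕ) (D : Fin k → ℕ) (σ : Equiv.Perm (Fin k)) : ℤ :=
  ∏ p ∈ Finset.univ.filter (fun p : Fin k × Fin k => p.1 < p.2 ∧ σ p.2 < σ p.1),
    (-1 : ℤ) ^ (D (σ p.1) * D (σ p.2))

/-- `σ` is an `(i, N-i)`-unshuffle: `σ(a) < σ(a+1)` whenever `a + 1 ≠ i`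
(`0`-indexed). -/
def IsUnshuffle (N i : ℕ) (σ : Equiv.Perm (Fin N)) : Prop :=
  ∀ a b : Fin N, (a : ℕ) + 1 = (b : ℕ) → (b : ℕ) ≠ i → σ a < σ b

/-- The bracket `⟦x, y⟧ = L_{v_x} y` of the differential graded Leibniz algebra: the Lie
derivative of `y` along the Hamiltonian vector field of the degree-`0` part of `x`. -/
noncomputable def leibBracket (m : ℕ) (ω : S.Form (m+2)) (x y : S.Cochain m) :
    S.Cochain m :=
  ⟨fun p => S.lieD p (S.hamVF m ω ((x : (p : ℕ) → S.Form p) m))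
      ((y : (p : ℕ) → S.Form p) p),
   by
    intro p hp
    show S.lieD p _ ((y : (p : ℕ) → S.Form p) p) = 0
    rw [y.2 p hp]
    simp [lieD]⟩

end Complex

theorem form_ext {k : ℕ} {α β : S.Form k}
    (h : ∀ x u, S.evalForm k α x u = S.evalForm k β x u) : α = β :=
  S.evalForm_injective k (funext fun x => AlternatingMap.ext (h x))

theorem iota_iota_self (k : ℕ) (X : S.VF) (α : S.Form (k+2)) :
    S.iota (k+1) X (S.iota (k+2) X α) = 0 := by
  refine S.form_ext fun x u => ?_
  refine (S.evalForm_iota k X _ x u).trans ((S.evalForm_iota (k+1) X α x _).trans ?_)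
  rw [map_zero]
  exact AlternatingMap.map_eq_zero_of_eq (i := 0) (j := 1) _ _ rfl (by simp)

theorem iota_iota_anticomm (k : ℕ) (X Y : S.VF) (α : S.Form (k+2)) :
    S.iota (k+1) X (S.iota (k+2) Y α) = - S.iota (k+1) Y (S.iota (k+2) X α) := by
  have h := S.iota_iota_self k (X + Y) α
  simp only [map_add, LinearMap.add_apply, S.iota_iota_self, zero_add, add_zero] at h
  exact eq_neg_of_add_eq_zero_right h

/-- A vector field `X` with `d ι_X ω = 0`; for closed `ω` this says that `X` preserves `ω`. -/
def IsLocHam (m : ℕ) (ω : S.Form (m+2)) (X : S.VF) : Prop :=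
  S.d (m+1) (S.iota (m+2) X ω) = 0

variable {S}

theorem IsHamPair.isLocHam {m : ℕ} {ω : S.Form (m+2)} {α : S.Form m} {X : S.VF}
    (h : S.IsHamPair m ω α X) : S.IsLocHam m ω X := by
  have h' := S.d_d m α
  rw [h, map_neg, neg_eq_zero] at h'
  exact h'

/-- The Lie bracket of Hamiltonian vector fields is a Hamiltonian vector field of the bracket. -/
theorem iota_bracketVF_of_isLocHam {m : ℕ} {ω : S.Form (m+2)} (hω : S.d (m+2) ω = 0)
    {X Y : S.VF} (hX : S.IsLocHam m ω X) (hY : S.IsLocHam m ω Y) :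
    S.iota (m+2) (S.bracketVF X Y) ω = - S.d m (S.hamBracket m ω X Y) := by
  have h := S.iota_bracketVF m X Y ω
  rw [show S.d (m+1) (S.iota (m+2) Y ω) = 0 from hY,
    show S.d (m+1) (S.iota (m+2) X ω) = 0 from hX, hω, S.iota_iota_anticomm] at h
  simpa [hamBracket] using h

variable (S)

/-- The failure of `ι_{[X,Y]} α = ι_X d ι_Y α - ι_Y d ι_X α` on a closed `1`-form `α`. -/
def bracketDefect (X Y : S.VF) (α : S.Form 1) : S.Form 0 :=
  S.iota 1 (S.bracketVF X Y) α - S.iota 1 X (S.d 0 (S.iota 1 Y α))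
    + S.iota 1 Y (S.d 0 (S.iota 1 X α))

theorem wedge_zero_zero_apply (f g : S.Form 0) (x : S.Point) (u : Fin 0 → S.Tangent x) :
    S.evalForm 0 (S.wedge 0 0 f g) x u = S.evalForm 0 f x u * S.evalForm 0 g x u := by
  refine (S.evalForm_wedge 0 0 f g x u).trans ?_
  simp [Subsingleton.elim _ u]

theorem wedge_zero_one_apply (f : S.Form 0) (β : S.Form 1) (x : S.Point)
    (u : Fin 1 → S.Tangent x) :
    S.evalForm 1 (S.wedge 0 1 f β) x u
      = S.evalForm 0 f x ![] * S.evalForm 1 β x u := by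
  refine (S.evalForm_wedge 0 1 f β x u).trans ?_
  have huniv : (Finset.univ : Finset (Equiv.Perm (Fin (0+1)))) = {1} := by decide
  rw [huniv, Finset.sum_singleton]
  have hu : (fun i : Fin 1 => u ((1 : Equiv.Perm (Fin (0+1))) (Fin.natAdd 0 i))) = u := by
    funext i
    fin_cases i
    rfl
  rw [hu, Subsingleton.elim (fun i => _) (![] : Fin 0 → S.Tangent x)]
  simp

theorem wedge_one_one_apply (α β : S.Form 1) (x : S.Point) (u : Fin 2 → S.Tangent x) :
    S.evalForm 2 (S.wedge 1 1 α β) x u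
      = S.evalForm 1 α x ![u 0] * S.evalForm 1 β x ![u 1]
        - S.evalForm 1 α x ![u 1] * S.evalForm 1 β x ![u 0] := by
  refine (S.evalForm_wedge 1 1 α β x u).trans ?_
  have huniv : (Finset.univ : Finset (Equiv.Perm (Fin (1+1)))) = {1, Equiv.swap 0 1} := by decide
  have hc : ∀ f : Fin 1 → S.Tangent x, f = ![f 0] := fun f => by
    funext i
    fin_cases i
    rfl
  rw [huniv, Finset.sum_pair (by decide)]
  rw [hc (fun i => u ((1 : Equiv.Perm (Fin (1+1))) (Fin.castAdd 1 i))),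
    hc (fun i => u ((1 : Equiv.Perm (Fin (1+1))) (Fin.natAdd 1 i))),
    hc (fun i => u ((Equiv.swap 0 1 : Equiv.Perm (Fin (1+1))) (Fin.castAdd 1 i))),
    hc (fun i => u ((Equiv.swap 0 1 : Equiv.Perm (Fin (1+1))) (Fin.natAdd 1 i)))]
  rw [show (Equiv.swap 0 1 : Equiv.Perm (Fin (1+1))) (Fin.castAdd 1 0) = 1 by decide,
    show (Equiv.swap 0 1 : Equiv.Perm (Fin (1+1))) (Fin.natAdd 1 0) = 0 by decide,
    show (1 : Equiv.Perm (Fin (1+1))) (Fin.castAdd 1 0) = 0 by decide,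
    show (1 : Equiv.Perm (Fin (1+1))) (Fin.natAdd 1 0) = 1 by decide,
    Equiv.Perm.sign_swap (by decide)]
  simp
  ring

theorem evalForm_iota_one (X : S.VF) (α : S.Form 1) (x : S.Point) (u : Fin 0 → S.Tangent x) :
    S.evalForm 0 (S.iota 1 X α) x u = S.evalForm 1 α x ![S.evalVF X x] := by
  rw [Subsingleton.elim u ![]]
  exact S.evalForm_iota 0 X α x ![]

theorem iota_wedge_one_one (X : S.VF) (α β : S.Form 1) :
    S.iota 2 X (S.wedge 1 1 α β)
      = S.wedge 0 1 (S.iota 1 X α) β - S.wedge 0 1 (S.iota 1 X β) α := by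
  refine S.form_ext fun x u => ?_
  have hu : u = ![u 0] := by
    funext i
    fin_cases i
    rfl
  refine (S.evalForm_iota 1 X _ x u).trans ((S.wedge_one_one_apply α β x _).trans ?_)
  refine Eq.trans ?_ (congrArg (fun f => f x u) (map_sub (S.evalForm 1) _ _)).symm
  refine Eq.trans ?_ (congrArg₂ (· - ·) (S.wedge_zero_one_apply (S.iota 1 X α) β x u)
    (S.wedge_zero_one_apply (S.iota 1 X β) α x u)).symm
  rw [evalForm_iota_one, evalForm_iota_one, hu]
  simp [mul_comm]

theorem iota_wedge_zero_one (X : S.VF) (f : S.Form 0) (β : S.Form 1) :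
    S.iota 1 X (S.wedge 0 1 f β) = S.wedge 0 0 f (S.iota 1 X β) := by
  refine S.form_ext fun x u => ?_
  refine (S.evalForm_iota_one X _ x u).trans ((S.wedge_zero_one_apply f β x _).trans ?_)
  refine Eq.trans ?_ (S.wedge_zero_zero_apply f (S.iota 1 X β) x u).symm
  rw [evalForm_iota_one, Subsingleton.elim (α := Fin 0 → S.Tangent x) u ![]]

theorem d_wedge_zero_one {β : S.Form 1} (hβ : S.d 1 β = 0) (f : S.Form 0) :
    S.d 1 (S.wedge 0 1 f β) = S.wedge 1 1 (S.d 0 f) β := by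
  refine (S.d_wedge 0 1 f β).trans ?_
  rw [hβ, map_zero, smul_zero]
  exact add_zero _

theorem wedge_one_zero (α : S.Form 1) (g : S.Form 0) :
    S.wedge 1 0 α g = S.wedge 0 1 g α := by
  refine S.form_ext fun x u => ?_
  refine (S.evalForm_wedge 1 0 α g x u).trans ?_
  refine Eq.trans ?_ (S.wedge_zero_one_apply g α x u).symm
  have huniv : (Finset.univ : Finset (Equiv.Perm (Fin (1+0)))) = {1} := by decide
  rw [huniv, Finset.sum_singleton]
  have hu : (fun i : Fin 1 => u ((1 : Equiv.Perm (Fin (1+0))) (Fin.castAdd 0 i))) = u := by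
    funext i
    fin_cases i
    rfl
  rw [hu, Subsingleton.elim (fun i => _) (![] : Fin 0 → S.Tangent x)]
  simp [mul_comm]

theorem d_wedge_zero_zero (f g : S.Form 0) :
    S.d 0 (S.wedge 0 0 f g) = S.wedge 0 1 g (S.d 0 f) + S.wedge 0 1 f (S.d 0 g) := by
  refine (S.d_wedge 0 0 f g).trans ?_
  rw [pow_zero, one_smul]
  exact congrArg (· + S.wedge 0 1 f (S.d 0 g)) (S.wedge_one_zero (S.d 0 f) g)

theorem d_wedge_one_one {α β : S.Form 1} (hα : S.d 1 α = 0) (hβ : S.d 1 β = 0) :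
    S.d 2 (S.wedge 1 1 α β) = 0 := by
  refine (S.d_wedge 1 1 α β).trans ?_
  rw [hα, hβ, map_zero, map_zero, smul_zero]
  simp

/-- The defect is a derivation which vanishes on `2`-forms, so it is compatible with
exchanging two closed `1`-forms. -/
theorem bracketDefect_wedge (X Y : S.VF) {α β : S.Form 1}
    (hα : S.d 1 α = 0) (hβ : S.d 1 β = 0) :
    S.wedge 0 1 (S.bracketDefect X Y α) β = S.wedge 0 1 (S.bracketDefect X Y β) α := by
  have h := S.iota_bracketVF 0 X Y (S.wedge 1 1 α β)
  have key (Z W : S.VF) : S.iota 2 Z (S.d 1 (S.iota 2 W (S.wedge 1 1 α β)))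
      = (S.wedge 0 1 (S.iota 1 Z (S.d 0 (S.iota 1 W α))) β
          - S.wedge 0 1 (S.iota 1 Z β) (S.d 0 (S.iota 1 W α)))
        - (S.wedge 0 1 (S.iota 1 Z (S.d 0 (S.iota 1 W β))) α
          - S.wedge 0 1 (S.iota 1 Z α) (S.d 0 (S.iota 1 W β))) := by
    refine (congrArg (fun γ => S.iota 2 Z (S.d 1 γ)) (S.iota_wedge_one_one W α β)).trans ?_
    refine (congrArg (S.iota 2 Z) ((map_sub (S.d 1) _ _).trans (congrArg₂ (· - ·)
      (S.d_wedge_zero_one hβ _) (S.d_wedge_zero_one hα _)))).trans ?_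
    exact (map_sub (S.iota 2 Z) _ _).trans (congrArg₂ (· - ·)
      (S.iota_wedge_one_one Z _ β) (S.iota_wedge_one_one Z _ α))
  have key0 : S.d 0 (S.iota 1 X (S.iota 2 Y (S.wedge 1 1 α β)))
      = (S.wedge 0 1 (S.iota 1 X β) (S.d 0 (S.iota 1 Y α))
          + S.wedge 0 1 (S.iota 1 Y α) (S.d 0 (S.iota 1 X β)))
        - (S.wedge 0 1 (S.iota 1 X α) (S.d 0 (S.iota 1 Y β))
          + S.wedge 0 1 (S.iota 1 Y β) (S.d 0 (S.iota 1 X α))) := by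
    refine (congrArg (fun γ => S.d 0 (S.iota 1 X γ)) (S.iota_wedge_one_one Y α β)).trans ?_
    refine (congrArg (S.d 0) ((map_sub (S.iota 1 X) _ _).trans (congrArg₂ (· - ·)
      (S.iota_wedge_zero_one X _ β) (S.iota_wedge_zero_one X _ α)))).trans ?_
    exact (map_sub (S.d 0) _ _).trans (congrArg₂ (· - ·)
      (S.d_wedge_zero_zero _ _) (S.d_wedge_zero_zero _ _))
  have hL := S.iota_wedge_one_one (S.bracketVF X Y) α β
  have hR : S.iota 2 Y (S.d 1 (S.iota 2 X (S.wedge 1 1 α β))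
      + S.iota 3 X (S.d 2 (S.wedge 1 1 α β)))
      = S.iota 2 Y (S.d 1 (S.iota 2 X (S.wedge 1 1 α β))) := by
    rw [S.d_wedge_one_one hα hβ, map_zero, add_zero]
  have h2 := hL.symm.trans (h.trans (congrArg₂ (· - ·)
    (congrArg₂ (· + ·) key0 (key X Y)) (hR.trans (key Y X))))
  have expand (γ δ : S.Form 1) : S.wedge 0 1 (S.bracketDefect X Y γ) δ
      = (S.wedge 0 1 (S.iota 1 (S.bracketVF X Y) γ) δ
        - S.wedge 0 1 (S.iota 1 X (S.d 0 (S.iota 1 Y γ))) δ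
        + S.wedge 0 1 (S.iota 1 Y (S.d 0 (S.iota 1 X γ))) δ : S.Form 1) := by
    have hlin (a b c : S.Form 0) : S.wedge 0 1 (a - b + c) δ
        = S.wedge 0 1 a δ - S.wedge 0 1 b δ + S.wedge 0 1 c δ := by
      simp only [map_add, map_sub, LinearMap.add_apply, LinearMap.sub_apply]
    exact hlin _ _ _
  have cancel (cα cβ p q r s xa xb ya yb : S.Form 1)
      (e : cα - cβ = ((p + q) - (r + s) + ((xa - p) - (xb - r))) - ((ya - s) - (yb - q))) :
      cα - xa + ya = cβ - xb + yb := by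
    rw [← sub_eq_zero] at e ⊢
    rw [← e]
    abel
  exact (expand α β).trans ((cancel _ _ _ _ _ _ _ _ _ _ h2).trans (expand β α).symm)

/-- The Jacobiator `ι_X d ι_Z ι_Y ω - ι_Y d ι_Z ι_X ω + ι_Z d ι_Y ι_X ω` of three vector fields
which preserve the `2`-form `ω`. -/
def jacobiator (ω : S.Form 2) (X Y Z : S.VF) : S.Form 0 :=
  S.iota 1 X (S.d 0 (S.hamBracket 0 ω Y Z)) - S.iota 1 Y (S.d 0 (S.hamBracket 0 ω X Z))
    + S.iota 1 Z (S.d 0 (S.hamBracket 0 ω X Y))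

theorem hamBracket_self (m : ℕ) (ω : S.Form (m+2)) (X : S.VF) : S.hamBracket m ω X X = 0 :=
  S.iota_iota_self m X ω

theorem hamBracket_skew (m : ℕ) (ω : S.Form (m+2)) (X Y : S.VF) :
    S.hamBracket m ω X Y = - S.hamBracket m ω Y X :=
  S.iota_iota_anticomm m Y X ω

theorem jacobiator_left_self (ω : S.Form 2) (X Y : S.VF) : S.jacobiator ω X Y X = 0 := by
  rw [jacobiator, S.hamBracket_skew 0 ω Y X, hamBracket_self]
  simp

theorem jacobiator_right_self (ω : S.Form 2) (X Y : S.VF) : S.jacobiator ω X Y Y = 0 := by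
  rw [jacobiator, hamBracket_self]
  simp

theorem jacobiator_swap (ω : S.Form 2) (X Y Z : S.VF) :
    S.jacobiator ω X Y Z = - S.jacobiator ω X Z Y := by
  rw [jacobiator, jacobiator, S.hamBracket_skew 0 ω Z Y]
  simp only [map_neg]
  abel

variable {S}

theorem bracketDefect_iota {ω : S.Form 2} (hω : S.d 2 ω = 0) {X Y : S.VF}
    (hX : S.IsLocHam 0 ω X) (hY : S.IsLocHam 0 ω Y) (Z : S.VF) :
    S.bracketDefect X Y (S.iota 2 Z ω) = S.jacobiator ω X Y Z := by
  have hXY : S.iota 1 (S.bracketVF X Y) (S.iota 2 Z ω)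
      = S.iota 1 Z (S.d 0 (S.hamBracket 0 ω X Y)) := by
    refine (S.iota_iota_anticomm 0 _ Z ω).trans ?_
    refine (congrArg (fun γ => - S.iota 1 Z γ) (iota_bracketVF_of_isLocHam hω hX hY)).trans ?_
    exact (congrArg Neg.neg (map_neg (S.iota 1 Z) _)).trans (neg_neg _)
  have h (V W : S.VF) : S.iota 1 V (S.d 0 (S.iota 1 W (S.iota 2 Z ω)))
      = - S.iota 1 V (S.d 0 (S.hamBracket 0 ω W Z)) := by
    refine (congrArg (fun γ => S.iota 1 V (S.d 0 γ)) (S.iota_iota_anticomm 0 W Z ω)).trans ?_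
    exact (congrArg (S.iota 1 V) (map_neg (S.d 0) _)).trans (map_neg (S.iota 1 V) _)
  refine (congrArg₂ (· + ·) (congrArg₂ (· - ·) hXY (h X Y)) (h Y X)).trans ?_
  have cancel (a b c : S.Form 0) : a - -b + -c = b - c + a := by abel
  exact cancel _ _ _

theorem wedge_jacobiator_left {ω : S.Form 2} (hω : S.d 2 ω = 0) {X Y Z : S.VF}
    (hX : S.IsLocHam 0 ω X) (hY : S.IsLocHam 0 ω Y) (hZ : S.IsLocHam 0 ω Z) :
    S.wedge 0 1 (S.jacobiator ω X Y Z) (S.iota 2 X ω) = 0 := by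
  have h := S.bracketDefect_wedge X Y hZ hX
  rw [bracketDefect_iota hω hX hY, bracketDefect_iota hω hX hY, jacobiator_left_self] at h
  exact h.trans (by simp)

theorem wedge_jacobiator_mid {ω : S.Form 2} (hω : S.d 2 ω = 0) {X Y Z : S.VF}
    (hX : S.IsLocHam 0 ω X) (hY : S.IsLocHam 0 ω Y) (hZ : S.IsLocHam 0 ω Z) :
    S.wedge 0 1 (S.jacobiator ω X Y Z) (S.iota 2 Y ω) = 0 := by
  have h := S.bracketDefect_wedge X Y hZ hY
  rw [bracketDefect_iota hω hX hY, bracketDefect_iota hω hX hY, jacobiator_right_self] at h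
  exact h.trans (by simp)

theorem wedge_jacobiator_right {ω : S.Form 2} (hω : S.d 2 ω = 0) {X Y Z : S.VF}
    (hX : S.IsLocHam 0 ω X) (hY : S.IsLocHam 0 ω Y) (hZ : S.IsLocHam 0 ω Z) :
    S.wedge 0 1 (S.jacobiator ω X Y Z) (S.iota 2 Z ω) = 0 := by
  rw [jacobiator_swap, map_neg, LinearMap.neg_apply, wedge_jacobiator_mid hω hX hZ hY, neg_zero]

variable (S)

theorem eq_zero_of_wedge_self {f : S.Form 0} (h : S.wedge 0 0 f f = 0) : f = 0 := by
  refine S.form_ext fun x u => ?_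
  have hx := S.wedge_zero_zero_apply f f x u
  rw [h] at hx
  rw [map_zero] at hx ⊢
  exact mul_self_eq_zero.mp hx.symm


/-- Let `(M, ω)` be an `n`-plectic manifold (here `n = m + 1`).  For
Hamiltonian `(n-1)`-forms `α₁, α₂, α₃` with Hamiltonian vector fields
`v₁, v₂, v₃`, the bracket `{α, β} = ι_{v_β} ι_{v_α} ω` satisfies the Jacobi identity up
to an exact `(n-1)`-form:
`{α₁,{α₂,α₃}} - {{α₁,α₂},α₃} - {α₂,{α₁,α₃}} = -d ι(v₁ ∧ v₂ ∧ v₃) ω`,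
where `ι(v₁ ∧ v₂ ∧ v₃) ω = ι_{v₃} ι_{v₂} ι_{v₁} ω` and `w₂₃, w₁₂, w₁₃` denote the
Hamiltonian vector fields of `{α₂,α₃}, {α₁,α₂}, {α₁,α₃}` respectively. -/
theorem hamBracket_jacobi_up_to_exact
    (m : ℕ) (ω : S.Form (m+2)) (hω : S.IsPlectic (m+1) ω)
    (α₁ α₂ α₃ : S.Form m) (v₁ v₂ v₃ : S.VF)
    (h₁ : S.IsHamPair m ω α₁ v₁) (h₂ : S.IsHamPair m ω α₂ v₂)
    (h₃ : S.IsHamPair m ω α₃ v₃)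
    (w₂₃ w₁₂ w₁₃ : S.VF)
    (h₂₃ : S.IsHamPair m ω (S.hamBracket m ω v₂ v₃) w₂₃)
    (h₁₂ : S.IsHamPair m ω (S.hamBracket m ω v₁ v₂) w₁₂)
    (h₁₃ : S.IsHamPair m ω (S.hamBracket m ω v₁ v₃) w₁₃) :
    S.hamBracket m ω v₁ w₂₃ - S.hamBracket m ω w₁₂ v₃ - S.hamBracket m ω v₂ w₁₃
      = - S.dLow m (show S.Form (m-1) from S.itIota (m+2) 3 ![v₁, v₂, v₃] ω) := by
  have hd : S.d (m+2) ω = 0 := hω.1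
  have l₁ := h₁.isLocHam
  have l₂ := h₂.isLocHam
  have l₃ := h₃.isLocHam
  cases m with
  | zero =>
    have hJ : S.hamBracket 0 ω v₁ w₂₃ - S.hamBracket 0 ω w₁₂ v₃ - S.hamBracket 0 ω v₂ w₁₃
        = S.jacobiator ω v₁ v₂ v₃ := by
      rw [jacobiator, h₂₃, h₁₂, h₁₃, S.hamBracket_skew 0 ω v₁, S.hamBracket_skew 0 ω v₂]
      simp only [hamBracket, map_neg]
      abel
    have hw {v : S.VF} (w : S.VF)
        (h : S.wedge 0 1 (S.jacobiator ω v₁ v₂ v₃) (S.iota 2 v ω) = 0) :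
        S.wedge 0 0 (S.jacobiator ω v₁ v₂ v₃) (S.hamBracket 0 ω v w) = 0 :=
      (S.iota_wedge_zero_one w _ _).symm.trans
        ((congrArg (S.iota 1 w) h).trans (map_zero (S.iota 1 w)))
    have hJJ : S.wedge 0 0 (S.jacobiator ω v₁ v₂ v₃) (S.jacobiator ω v₁ v₂ v₃) = 0 := by
      conv_lhs => arg 2; rw [← hJ, S.hamBracket_skew 0 ω w₁₂]
      rw [map_sub, map_sub, map_neg, hw w₂₃ (wedge_jacobiator_left hd l₁ l₂ l₃),
        hw w₁₃ (wedge_jacobiator_mid hd l₁ l₂ l₃),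
        hw w₁₂ (wedge_jacobiator_right hd l₁ l₂ l₃)]
      simp
    rw [hJ, S.eq_zero_of_wedge_self hJJ]
    simp [dLow]
  | succ k =>
    have b₁₂ : S.iota (k+3) (S.bracketVF v₁ v₂) ω = S.iota (k+3) w₁₂ ω := by
      refine (iota_bracketVF_of_isLocHam hd l₁ l₂).trans ?_
      rw [h₁₂, neg_neg]
    have e := S.iota_bracketVF k v₁ v₂ (S.iota (k+3) v₃ ω)
    have e₂₃ : S.d (k+1) (S.iota (k+2) v₂ (S.iota (k+3) v₃ ω)) = S.iota (k+3) w₂₃ ω := by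
      refine (congrArg (S.d (k+1)) (S.iota_iota_anticomm (k+1) v₂ v₃ ω)).trans ?_
      exact (map_neg (S.d (k+1)) _).trans (neg_eq_iff_eq_neg.mpr h₂₃)
    have e₁₃ : S.d (k+1) (S.iota (k+2) v₁ (S.iota (k+3) v₃ ω)) = S.iota (k+3) w₁₃ ω := by
      refine (congrArg (S.d (k+1)) (S.iota_iota_anticomm (k+1) v₁ v₃ ω)).trans ?_
      exact (map_neg (S.d (k+1)) _).trans (neg_eq_iff_eq_neg.mpr h₁₃)
    have e₃ : S.d (k+2) (S.iota (k+3) v₃ ω) = 0 := l₃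
    have eL : S.iota (k+2) (S.bracketVF v₁ v₂) (S.iota (k+3) v₃ ω)
        = - S.hamBracket (k+1) ω w₁₂ v₃ :=
      (S.iota_iota_anticomm (k+1) _ v₃ ω).trans
        (congrArg (fun γ => - S.iota (k+2) v₃ γ) b₁₂)
    have eD : S.iota (k+1) v₁ (S.iota (k+2) v₂ (S.iota (k+3) v₃ ω))
        = - S.itIota (k+3) 3 ![v₁, v₂, v₃] ω := by
      refine (congrArg (S.iota (k+1) v₁) (S.iota_iota_anticomm (k+1) v₂ v₃ ω)).trans ?_
      refine (map_neg (S.iota (k+1) v₁) _).trans (congrArg Neg.neg ?_)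
      refine (S.iota_iota_anticomm k v₁ v₃ (S.iota (k+3) v₂ ω)).trans ?_
      refine (congrArg (fun γ => - S.iota (k+1) v₃ γ)
        (S.iota_iota_anticomm (k+1) v₁ v₂ ω)).trans ?_
      exact (congrArg Neg.neg (map_neg (S.iota (k+1) v₃) _)).trans (neg_neg _)
    have e' : - S.hamBracket (k+1) ω w₁₂ v₃
        = S.d k (- S.itIota (k+3) 3 ![v₁, v₂, v₃] ω)
          + (- S.hamBracket (k+1) ω v₁ w₂₃) - (- S.hamBracket (k+1) ω v₂ w₁₃) := by
      refine eL.symm.trans (e.trans (congrArg₂ (· - ·) (congrArg₂ (· + ·)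
        (congrArg (S.d k) eD) ?_) ?_))
      · exact (congrArg (S.iota (k+2) v₁) e₂₃).trans (S.iota_iota_anticomm (k+1) v₁ w₂₃ ω)
      · refine (congrArg (S.iota (k+2) v₂) (congrArg₂ (fun γ δ : S.Form (k+2) => γ + δ) e₁₃
          ((congrArg (S.iota (k+3) v₁) e₃).trans (map_zero (S.iota (k+3) v₁))))).trans ?_
        exact (congrArg (S.iota (k+2) v₂) (add_zero _)).trans
          (S.iota_iota_anticomm (k+1) v₂ w₁₃ ω)
    have cancel (a b c t : S.Form (k+1)) (h : -b = -t + -a - -c) : a - b - c = -t := by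
      rw [← sub_eq_zero] at h ⊢
      rw [← h]
      abel
    exact cancel _ _ _ _ (e'.trans (by rw [map_neg]; rfl))

end CartanCalculus
end

section
/- Let (M,ω) be an n-plectic manifold. For Hamiltonian (n−1)-forms α and β with Hamiltonian vector fields v_α and v_β, the bracket ⟦α,β⟧ = L_{v_α} β is skew-symmetric up to an exact (n−1)-form: ⟦α,β⟧ + ⟦β,α⟧ = d(ι_{v_α} β + ι_{v_β} α). -/
open scoped Classical

namespace CartanCalculus

variable (S : CartanCalculus)

/-- Interior products anticommute. -/
theorem iota_iota_add_iota_iota (k : ℕ) (X Y : S.VF) (ω : S.Form (k+2)) :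
    S.iota (k+1) X (S.iota (k+2) Y ω) + S.iota (k+1) Y (S.iota (k+2) X ω) = 0 := by
  apply S.evalForm_injective k
  rw [map_add, map_zero]
  funext x
  ext u
  have swap := (S.evalForm (k+2) ω x).map_swap
    (Fin.cons (S.evalVF X x) (Fin.cons (S.evalVF Y x) u)) (Fin.zero_ne_one (n := k))
  have cons_swap : (Fin.cons (S.evalVF X x) (Fin.cons (S.evalVF Y x) u) :
      Fin (k+2) → S.Tangent x) ∘ Equiv.swap 0 1
      = Fin.cons (S.evalVF Y x) (Fin.cons (S.evalVF X x) u) := by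
    funext i
    refine Fin.cases ?_ (fun j => Fin.cases ?_ (fun l => ?_) j) i
    · rw [Function.comp_apply, Equiv.swap_apply_left]
      rfl
    · simp
    · rw [Function.comp_apply, Equiv.swap_apply_of_ne_of_ne (Fin.succ_ne_zero _)
        (Fin.succ_succ_ne_one l)]
      simp
  rw [cons_swap] at swap
  have hXY := (S.evalForm_iota k X (S.iota (k+2) Y ω) x u).trans
    (S.evalForm_iota (k+1) Y ω x _)
  have hYX := (S.evalForm_iota k Y (S.iota (k+2) X ω) x u).trans
    (S.evalForm_iota (k+1) X ω x _)
  have hsum := congrArg₂ (· + ·) hXY hYX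
  simp only [swap, neg_add_cancel] at hsum
  exact hsum

/-- Let `(M, ω)` be an `n`-plectic manifold (here `n = m + 1`).  For
Hamiltonian `(n-1)`-forms `α` and `β` with Hamiltonian vector fields `v_α` and `v_β`,
the bracket `⟦α, β⟧ = L_{v_α} β` is skew-symmetric up to an exact `(n-1)`-form:
`⟦α, β⟧ + ⟦β, α⟧ = d (ι_{v_α} β + ι_{v_β} α)`. -/
theorem lieD_add_lieD_eq_d_iota_add
    (m : ℕ) (ω : S.Form (m+2)) (hω : S.IsPlectic (m+1) ω)
    (α β : S.Form m) (vα vβ : S.VF)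
    (hα : S.IsHamPair m ω α vα) (hβ : S.IsHamPair m ω β vβ) :
    S.lieD m vα β + S.lieD m vβ α
      = S.dLow m (S.iota m vα β + S.iota m vβ α) := by
  have contraction : S.iota (m+1) vα (S.d m β) + S.iota (m+1) vβ (S.d m α) = 0 := by
    rw [hα, hβ, map_neg, map_neg, ← neg_add]
    exact neg_eq_zero.mpr (S.iota_iota_add_iota_iota m vα vβ ω)
  rw [map_add]
  exact (add_add_add_comm _ _ _ _).trans ((congrArg _ contraction).trans (add_zero _))

end CartanCalculus
end

section
/- Let (M,g) be a hyper-Kähler manifold: a Riemannian manifold with three almost complex structures J₁, J₂, J₃ satisfying J₁² = J₂² = −id, J₁J₂ = −J₂J₁, J₃ = J₁J₂, each J_i preserving the metric g, and such that each 2-form θ_i defined by θ_i(v₁,v₂) = g(v₁, J_i v₂) is closed. Then the 4-form ω = θ₁∧θ₁ + θ₂∧θ₂ + θ₃∧θ₃ is closed and nondegenerate (ι_v ω = 0 implies v = 0); hence (M,ω) is a 3-plectic manifold. -/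
open scoped Classical

namespace CartanCalculus

variable (S : CartanCalculus)

/-- Expansion of a sum over the permutations of four letters. -/
theorem sum_sign_perm_fin_four (f : Fin 4 → Fin 4 → Fin 4 → Fin 4 → ℝ) :
    ∑ σ : Equiv.Perm (Fin 4), ((Equiv.Perm.sign σ : ℤ) : ℝ) * f (σ 0) (σ 1) (σ 2) (σ 3) =
      f 0 1 2 3 - f 0 1 3 2 - f 0 2 1 3 + f 0 2 3 1 + f 0 3 1 2 - f 0 3 2 1
      - f 1 0 2 3 + f 1 0 3 2 + f 1 2 0 3 - f 1 2 3 0 - f 1 3 0 2 + f 1 3 2 0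
      + f 2 0 1 3 - f 2 0 3 1 - f 2 1 0 3 + f 2 1 3 0 + f 2 3 0 1 - f 2 3 1 0
      - f 3 0 1 2 + f 3 0 2 1 + f 3 1 0 2 - f 3 1 2 0 - f 3 2 0 1 + f 3 2 1 0 := by
  have apply_two (p : Fin 3) (τ : Equiv.Perm (Fin 2)) :
      Equiv.Perm.decomposeFin.symm (p, τ) 2 = Equiv.swap 0 p (τ 1).succ :=
    Equiv.Perm.decomposeFin_symm_apply_succ τ p 1
  have apply_two' (p : Fin 4) (τ : Equiv.Perm (Fin 3)) :
      Equiv.Perm.decomposeFin.symm (p, τ) 2 = Equiv.swap 0 p (τ 1).succ :=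
    Equiv.Perm.decomposeFin_symm_apply_succ τ p 1
  have apply_three (p : Fin 4) (τ : Equiv.Perm (Fin 3)) :
      Equiv.Perm.decomposeFin.symm (p, τ) 3 = Equiv.swap 0 p (τ 2).succ :=
    Equiv.Perm.decomposeFin_symm_apply_succ τ p 2
  rw [Finset.univ_perm_fin_succ, ← Finset.univ_product_univ]
  simp [Finset.sum_product, Fin.sum_univ_succ, Finset.univ_perm_fin_succ,
    ← Finset.univ_product_univ, Equiv.Perm.decomposeFin.symm_sign,
    apply_two, apply_two', apply_three, Equiv.swap_apply_def]
  ring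

/-- The square of a `2`-form, evaluated on four tangent vectors. -/
theorem evalForm_wedge_self_two (θ : S.Form 2) (x : S.Point)
    (a b c e : S.Tangent x) (B : S.Tangent x → S.Tangent x → ℝ)
    (hB : ∀ u : Fin 2 → S.Tangent x, S.evalForm 2 θ x u = B (u 0) (u 1)) :
    S.evalForm 4 (S.wedge 2 2 θ θ) x ![a, b, c, e] =
      2 * (B a b * B c e - B a c * B b e + B a e * B b c) := by
  have skew : ∀ a b, B a b = -B b a := fun a b => by
    have h := (S.evalForm 2 θ x).map_swap ![a, b] (i := 0) (j := 1) (by decide)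
    simp only [hB] at h
    simpa using congrArg Neg.neg h.symm
  have h := S.evalForm_wedge 2 2 θ θ x ![a, b, c, e]
  simp only [hB] at h
  refine h.trans ?_
  have key := sum_sign_perm_fin_four
    (fun i j k l => B (![a, b, c, e] i) (![a, b, c, e] j) *
      B (![a, b, c, e] k) (![a, b, c, e] l))
  refine (congrArg _ key).trans ?_
  simp only [Matrix.cons_val]
  rw [skew b a, skew c a, skew e a, skew c b, skew e b, skew e c]
  norm_num
  ring

/-- The square of a closed `2`-form is closed. -/
theorem d_wedge_self_two (θ : S.Form 2) (hθ : S.d 2 θ = 0) :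
    S.d 4 (S.wedge 2 2 θ θ) = 0 := by
  refine (S.d_wedge 2 2 θ θ).trans ?_
  simp [hθ]

/-- Let `(M, g)` be a hyper-Kähler manifold: a Riemannian manifold
(`g` a symmetric positive-definite metric on the tangent spaces) with three almost
complex structures `J₁, J₂, J₃` satisfying `J₁² = J₂² = -id`, `J₁J₂ = -J₂J₁`,
`J₃ = J₁J₂`, each `J_i` preserving the metric `g`, and such that each `2`-form `θ_i`
defined by `θ_i(v₁, v₂) = g(v₁, J_i v₂)` is closed.  Then the `4`-form
`ω = θ₁∧θ₁ + θ₂∧θ₂ + θ₃∧θ₃` is closed and nondegenerate (`ι_v ω = 0` implies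
`v = 0`); hence `(M, ω)` is a `3`-plectic manifold. -/
theorem hyperKaehler_isPlectic
    (g : ∀ x : S.Point, S.Tangent x →ₗ[ℝ] S.Tangent x →ₗ[ℝ] ℝ)
    (gsymm : ∀ x u v, g x u v = g x v u)
    (gposdef : ∀ (x : S.Point) (v : S.Tangent x), v ≠ 0 → 0 < g x v v)
    (J₁ J₂ J₃ : ∀ x : S.Point, S.Tangent x →ₗ[ℝ] S.Tangent x)
    (hJ₁ : ∀ x v, J₁ x (J₁ x v) = -v)
    (hJ₂ : ∀ x v, J₂ x (J₂ x v) = -v)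
    (hanti : ∀ x v, J₁ x (J₂ x v) = - J₂ x (J₁ x v))
    (hJ₃ : ∀ x v, J₃ x v = J₁ x (J₂ x v))
    (hg₁ : ∀ x u v, g x (J₁ x u) (J₁ x v) = g x u v)
    (hg₂ : ∀ x u v, g x (J₂ x u) (J₂ x v) = g x u v)
    (hg₃ : ∀ x u v, g x (J₃ x u) (J₃ x v) = g x u v)
    (θ₁ θ₂ θ₃ : S.Form 2)
    (hθ₁ : ∀ (x : S.Point) (v : Fin 2 → S.Tangent x),
      S.evalForm 2 θ₁ x v = g x (v 0) (J₁ x (v 1)))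
    (hθ₂ : ∀ (x : S.Point) (v : Fin 2 → S.Tangent x),
      S.evalForm 2 θ₂ x v = g x (v 0) (J₂ x (v 1)))
    (hθ₃ : ∀ (x : S.Point) (v : Fin 2 → S.Tangent x),
      S.evalForm 2 θ₃ x v = g x (v 0) (J₃ x (v 1)))
    (hc₁ : S.d 2 θ₁ = 0) (hc₂ : S.d 2 θ₂ = 0) (hc₃ : S.d 2 θ₃ = 0) :
    S.IsPlectic 3
      (S.wedge 2 2 θ₁ θ₁ + S.wedge 2 2 θ₂ θ₂ + S.wedge 2 2 θ₃ θ₃) := by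
  refine ⟨?_, fun x v hv => ?_⟩
  · have h₁ := S.d_wedge_self_two θ₁ hc₁
    have h₂ := S.d_wedge_self_two θ₂ hc₂
    have h₃ := S.d_wedge_self_two θ₃ hc₃
    simp only [map_add, h₁, h₂, h₃, add_zero]
  · by_contra hne
    have hpos := gposdef x v hne
    have hv' := hv ![J₁ x v, J₂ x v, J₃ x v]
    have e₁ := S.evalForm_wedge_self_two θ₁ x v (J₁ x v) (J₂ x v) (J₃ x v)
      (fun a b => g x a (J₁ x b)) (hθ₁ x)
    have e₂ := S.evalForm_wedge_self_two θ₂ x v (J₁ x v) (J₂ x v) (J₃ x v)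
      (fun a b => g x a (J₂ x b)) (hθ₂ x)
    have e₃ := S.evalForm_wedge_self_two θ₃ x v (J₁ x v) (J₂ x v) (J₃ x v)
      (fun a b => g x a (J₃ x b)) (hθ₃ x)
    have e : S.evalForm 4 (S.wedge 2 2 θ₁ θ₁) x ![v, J₁ x v, J₂ x v, J₃ x v]
        + S.evalForm 4 (S.wedge 2 2 θ₂ θ₂) x ![v, J₁ x v, J₂ x v, J₃ x v]
        + S.evalForm 4 (S.wedge 2 2 θ₃ θ₃) x ![v, J₁ x v, J₂ x v, J₃ x v] = 0 := by
      simp only [map_add, Pi.add_apply, AlternatingMap.add_apply] at hv'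
      exact hv'
    rw [e₁, e₂, e₃] at e
    have hJ₂₁ : ∀ w, J₂ x (J₁ x w) = -J₁ x (J₂ x w) := fun w => by rw [hanti, neg_neg]
    have o₁ : g x v (J₁ x v) = 0 := by
      have h := hg₁ x v (J₁ x v)
      rw [hJ₁, map_neg, gsymm] at h
      linarith
    have o₂ : g x v (J₂ x v) = 0 := by
      have h := hg₂ x v (J₂ x v)
      rw [hJ₂, map_neg, gsymm] at h
      linarith
    simp [hJ₃, hJ₁, hJ₂, hJ₂₁, hg₁, hg₂, o₁, o₂, gsymm x (J₂ x v) (J₁ x v)] at e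
    nlinarith [mul_pos hpos hpos]

end CartanCalculus
end
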